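/- For every τ ∈ (0, 1/2] there exists d_τ > 0 such that: if E, F ⊆ ℝ² are convex bodies with t(E,F) ∈ [τ, 1−τ] and δ(E,F) ≤ d_τ, then ω(E,F) ≤ 21·α(E,F). -/

import Mathlib

open Pointwise Real MeasureTheory

/-- The Euclidean plane. -/
abbrev Plane := EuclideanSpace ℝ (Fin 2)

/-- The linear endomorphism of the plane sending the standard basis to `p, q`. -/
noncomputable def frameMap (p q : Plane) : Plane →ₗ[ℝ] Plane where
  toFun y := y 0 • p + y 1 • q
  map_add' x y := by simp only [PiLp.add_apply, add_smul]; abel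
  map_smul' c x := by simp [mul_smul]

lemma frameMap_apply (p q y : Plane) : frameMap p q y = y 0 • p + y 1 • q := rfl

lemma det_frameMap (p q : Plane) : LinearMap.det (frameMap p q) = p 0 * q 1 - p 1 * q 0 := by
  rw [← LinearMap.det_toMatrix (EuclideanSpace.basisFun (Fin 2) ℝ).toBasis, Matrix.det_fin_two]
  simp [LinearMap.toMatrix_apply, frameMap_apply]
  ring

lemma det_frameMap_smul (a b : ℝ) (p q : Plane) :
    LinearMap.det (frameMap (a • p) (b • q)) = a * b * LinearMap.det (frameMap p q) := by
  simp only [det_frameMap, PiLp.smul_apply, smul_eq_mul]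
  ring

lemma Convex.smul_add_smul_mem_of_zero_mem {E : Set Plane} (hE : Convex ℝ E) (h0 : 0 ∈ E)
    {x y : Plane} (hx : x ∈ E) (hy : y ∈ E) {a b : ℝ} (ha : 0 ≤ a) (hb : 0 ≤ b)
    (hab : a + b ≤ 1) : a • x + b • y ∈ E := by
  have h := hE.sum_mem (t := Finset.univ) (w := ![a, b, 1 - a - b]) (z := ![x, y, 0])
    (by intro i _; fin_cases i <;> simp <;> linarith)
    (by simp [Fin.sum_univ_three])
    (by intro i _; fin_cases i <;> simp [hx, hy, h0])
  simpa [Fin.sum_univ_three] using h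

/-- The half-open standard triangle. -/
def stdTriangle : Set Plane := {y | 0 < y 0 ∧ 0 < y 1 ∧ y 0 + y 1 ≤ 1}

/-- The open cone spanned by two vectors. -/
def openCone (e f : Plane) : Set Plane := {z | ∃ a b : ℝ, 0 < a ∧ 0 < b ∧ z = a • e + b • f}

/-- A point of the cone maximising the sum of the coordinates over a compact set. -/
lemma exists_maximal_coords {G : Set Plane} (hG : IsCompact G) {e f : Plane} {r : ℝ}
    (hr : 0 ≤ r) (hr1 : r ≤ 1) (he : r • e ∈ G) :
    ∃ a b : ℝ, 0 ≤ a ∧ a ≤ 1 ∧ 0 ≤ b ∧ b ≤ 1 ∧ a • e + b • f ∈ G ∧ r ≤ a + b ∧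
      ∀ a' b' : ℝ, 0 ≤ a' → a' ≤ 1 → 0 ≤ b' → b' ≤ 1 → a' • e + b' • f ∈ G →
        a' + b' ≤ a + b := by
  have hcont : Continuous fun x : ℝ × ℝ => x.1 • e + x.2 • f := by fun_prop
  have hS : IsCompact ((Set.Icc (0 : ℝ) 1 ×ˢ Set.Icc (0 : ℝ) 1) ∩
      (fun x : ℝ × ℝ => x.1 • e + x.2 • f) ⁻¹' G) :=
    (isCompact_Icc.prod isCompact_Icc).inter_right (hG.isClosed.preimage hcont)
  obtain ⟨⟨a, b⟩, ⟨⟨ha, hb⟩, hab⟩, hmax⟩ := hS.exists_isMaxOn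
    ⟨(r, 0), ⟨⟨⟨hr, hr1⟩, by simp⟩, by simpa using he⟩⟩
    (f := fun x : ℝ × ℝ => x.1 + x.2) (by fun_prop)
  have hmax' : ∀ a' b' : ℝ, 0 ≤ a' → a' ≤ 1 → 0 ≤ b' → b' ≤ 1 → a' • e + b' • f ∈ G →
        a' + b' ≤ a + b := fun a' b' h1 h2 h3 h4 h5 =>
    hmax (show (a', b') ∈ _ from ⟨⟨⟨h1, h2⟩, ⟨h3, h4⟩⟩, h5⟩)
  exact ⟨a, b, ha.1, ha.2, hb.1, hb.2, hab,
    by simpa using hmax' r 0 hr hr1 le_rfl zero_le_one (by simpa using he), hmax'⟩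

/-- The triangle `g, f, g - a (e - g)`, with `g = a e + b f` maximal in `E ∩ F`, lies in
`F \ E`. -/
lemma volume_triangle_le {E F : Set Plane} (hE : Convex ℝ E) (hF : Convex ℝ F)
    (h0F : 0 ∈ F) {e f : Plane} (he : e ∈ E) (hf : f ∈ F) {a b : ℝ}
    (ha : 0 ≤ a) (ha1 : a ≤ 1) (hb : 0 ≤ b) (hab : a + b < 1)
    (hg : a • e + b • f ∈ E ∩ F)
    (hmax : ∀ a' b' : ℝ, 0 ≤ a' → a' ≤ 1 → 0 ≤ b' → b' ≤ 1 → a' • e + b' • f ∈ E ∩ F →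
        a' + b' ≤ a + b) :
    ENNReal.ofReal a * volume (frameMap (e - (a • e + b • f)) (f - (a • e + b • f)) '' stdTriangle)
      ≤ volume ((F \ E) ∩ openCone e f) := by
  rcases ha.eq_or_lt with rfl | ha0
  · simp
  set g := a • e + b • f with hgdef
  have key : (fun z => g + z) '' (frameMap ((-a) • (e - g)) ((1 : ℝ) • (f - g)) '' stdTriangle) ⊆
      (F \ E) ∩ openCone e f := by
    rintro _ ⟨_, ⟨y, ⟨hy0, hy1, hy⟩, rfl⟩, rfl⟩
    simp only [frameMap_apply]
    set s := y 0
    set t := y 1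
    have hst : 0 < s * a := by positivity
    refine ⟨⟨?_, fun hw => ?_⟩, ?_⟩
    · have := hF.smul_add_smul_mem_of_zero_mem h0F hg.2 hf (a := 1 - s - t + s * a)
        (b := s * b + t) (by nlinarith) (by positivity) (by nlinarith)
      convert this using 1
      simp only [hgdef]
      module
    · have hpos : 0 < 1 + s * a := by positivity
      have hc : 0 < t / (1 + s * a) := by positivity
      have hc1 : t / (1 + s * a) ≤ 1 := by rw [div_le_one hpos]; nlinarith
      have heq : g + (t / (1 + s * a)) • (f - g) = (s * a / (1 + s * a)) • e +
          (1 / (1 + s * a)) • (g + (s • (-a) • (e - g) + t • (1 : ℝ) • (f - g))) := by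
        have : (1 + s * a) ≠ 0 := hpos.ne'
        match_scalars <;> field_simp <;> ring
      have hmemE : g + (t / (1 + s * a)) • (f - g) ∈ E := by
        rw [heq]
        exact hE he hw (by positivity) (by positivity) (by field_simp; ring)
      have hmemF : g + (t / (1 + s * a)) • (f - g) ∈ F :=
        hF.add_smul_sub_mem hg.2 hf ⟨hc.le, hc1⟩
      set c := t / (1 + s * a)
      have := hmax (a * (1 - c)) (b + c * (1 - b)) (by nlinarith) (by nlinarith) (by nlinarith)
        (by nlinarith) (by
          have h : (a * (1 - c)) • e + (b + c * (1 - b)) • f = g + c • (f - g) := by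
            simp only [hgdef]; module
          rw [h]; exact ⟨hmemE, hmemF⟩)
      nlinarith
    · refine ⟨a * (1 - s * (1 - a) - t), b + s * a * b + t * (1 - b), ?_, ?_, ?_⟩
      · have : 0 < 1 - s * (1 - a) - t := by nlinarith
        positivity
      · have : 0 < t * (1 - b) := by apply mul_pos hy1; linarith
        positivity
      · simp only [hgdef]
        module
  calc _ = volume ((fun z => g + z) ''
        (frameMap ((-a) • (e - g)) ((1 : ℝ) • (f - g)) '' stdTriangle)) := by
        rw [Set.image_add_left, measure_preimage_add, Measure.addHaar_image_linearMap,
          Measure.addHaar_image_linearMap, det_frameMap_smul, mul_one, abs_mul, abs_neg,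
          abs_of_pos ha0, ENNReal.ofReal_mul ha, mul_assoc]
    _ ≤ _ := measure_mono key

lemma openCone_comm (e f : Plane) : openCone e f = openCone f e := by
  ext z
  constructor <;> rintro ⟨a, b, ha, hb, rfl⟩ <;> exact ⟨b, a, hb, ha, add_comm _ _⟩

lemma frameMap_image_stdTriangle_comm (p q : Plane) :
    frameMap p q '' stdTriangle = frameMap q p '' stdTriangle := by
  have : ∀ p q : Plane, frameMap p q '' stdTriangle ⊆ frameMap q p '' stdTriangle := by
    rintro p q _ ⟨y, ⟨h0, h1, h2⟩, rfl⟩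
    exact ⟨!₂[y 1, y 0], ⟨by simpa using h1, by simpa using h0, by simpa [add_comm] using h2⟩,
      by simp [frameMap_apply, add_comm]⟩
  exact (this p q).antisymm (this q p)

lemma volume_gap_openCone_le {E F : Set Plane} (hE : Convex ℝ E) (hF : Convex ℝ F)
    (hEc : IsCompact E) (hFc : IsCompact F) (h0E : 0 ∈ E) (h0F : 0 ∈ F) {e f : Plane}
    (he : e ∈ E) (hf : f ∈ F) (hef : Disjoint (segment ℝ e f) (E ∩ F))
    (hs : (1 / 20 : ℝ) • e ∈ F) :
    volume ({z | ∃ a b : ℝ, 0 < a ∧ 0 < b ∧ a + b ≤ 1 ∧ z = a • e + b • f} \ (E ∪ F)) ≤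
      20 * volume (symmDiff E F ∩ openCone e f) := by
  have hs' : (1 / 20 : ℝ) • e ∈ E ∩ F := by
    refine ⟨?_, hs⟩
    simpa using hE.smul_add_smul_mem_of_zero_mem h0E he h0E (a := 1 / 20) (b := 0)
      (by norm_num) le_rfl (by norm_num)
  obtain ⟨a, b, ha, ha1, hb, hb1, hg, hm, hmax⟩ := exists_maximal_coords (f := f)
    (hEc.inter hFc) (by norm_num) (by norm_num) hs'
  have hab : a + b < 1 := by
    by_contra! hcon
    have hpos : 0 < a + b := by linarith
    have hmem : (a + b)⁻¹ • (a • e + b • f) ∈ E ∩ F := by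
      have h1 : (a + b)⁻¹ ≤ 1 := inv_le_one_of_one_le₀ hcon
      have h2 : 0 ≤ (a + b)⁻¹ := by positivity
      constructor
      · simpa using hE.smul_add_smul_mem_of_zero_mem h0E hg.1 h0E (b := 0) h2 le_rfl (by simpa)
      · simpa using hF.smul_add_smul_mem_of_zero_mem h0F hg.2 h0F (b := 0) h2 le_rfl (by simpa)
    refine Set.disjoint_left.1 hef ?_ hmem
    refine ⟨a / (a + b), b / (a + b), by positivity, by positivity, by field_simp, ?_⟩
    match_scalars <;> field_simp
  set g := a • e + b • f with hgdef
  set X := volume (frameMap (e - g) (f - g) '' stdTriangle) with hX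
  have hF1 : ENNReal.ofReal a * X ≤ volume ((F \ E) ∩ openCone e f) :=
    volume_triangle_le hE hF h0F he hf ha ha1 hb hab hg hmax
  have hE1 : ENNReal.ofReal b * X ≤ volume ((E \ F) ∩ openCone e f) := by
    have := volume_triangle_le hF hE h0E hf he (a := b) (b := a) hb hb1 ha (by linarith)
      (by rw [Set.inter_comm, add_comm]; exact hg)
      (fun a' b' h1 h2 h3 h4 h5 => by
        have := hmax b' a' h3 h4 h1 h2 (by rw [Set.inter_comm, add_comm]; exact h5)
        linarith)
    rwa [add_comm (b • f), frameMap_image_stdTriangle_comm, openCone_comm] at this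
  have hgap : {z | ∃ a b : ℝ, 0 < a ∧ 0 < b ∧ a + b ≤ 1 ∧ z = a • e + b • f} \ (E ∪ F) ⊆
      (fun z => g + z) '' (frameMap (e - g) (f - g) '' stdTriangle) := by
    rintro _ ⟨⟨x, y, hx, hy, hxy, rfl⟩, hz⟩
    rw [Set.mem_union, not_or] at hz
    have h1 : (1 - a - b) ≠ 0 := by linarith
    have h1' : 0 < 1 - a - b := by linarith
    have hEmem : ∀ u v : ℝ, 0 ≤ u → 0 ≤ v → u + v ≤ 1 → u • g + v • e ∈ E := fun u v hu hv huv =>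
      hE.smul_add_smul_mem_of_zero_mem h0E hg.1 he hu hv huv
    have hFmem : ∀ u v : ℝ, 0 ≤ u → 0 ≤ v → u + v ≤ 1 → u • g + v • f ∈ F := fun u v hu hv huv =>
      hF.smul_add_smul_mem_of_zero_mem h0F hg.2 hf hu hv huv
    have hlam : 0 < x * (1 - b) + a * y - a := by
      by_contra! hcon
      rcases le_total (a * y) (b * x) with h | h
      · have hb0 : 0 < b := by
          rcases hb.eq_or_lt with hb0 | hb0
          · subst hb0; nlinarith
          · exact hb0
        apply hz.1
        have : x • e + y • f = (y / b) • g + (x - a * y / b) • e := by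
          simp only [hgdef]; match_scalars <;> field_simp; ring
        rw [this]
        refine hEmem _ _ (by positivity) ?_ ?_
        · rw [sub_nonneg, div_le_iff₀ hb0]; linarith
        · have : y / b + (x - a * y / b) = (y * (1 - a) + b * x) / b := by field_simp; ring
          rw [this, div_le_one hb0]
          nlinarith
      · have ha0 : 0 < a := by
          rcases ha.eq_or_lt with ha0 | ha0
          · subst ha0; nlinarith
          · exact ha0
        apply hz.2
        have : x • e + y • f = (x / a) • g + (y - b * x / a) • f := by
          simp only [hgdef]; match_scalars <;> field_simp; ring
        rw [this]
        refine hFmem _ _ (by positivity) ?_ ?_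
        · rw [sub_nonneg, div_le_iff₀ ha0]; linarith
        · have : x / a + (y - b * x / a) = (x * (1 - b) + a * y) / a := by field_simp; ring
          rw [this, div_le_one ha0]
          linarith
    have hmu : 0 < y * (1 - a) + b * x - b := by
      by_contra! hcon
      rcases le_total (a * y) (b * x) with h | h
      · have hb0 : 0 < b := by
          rcases hb.eq_or_lt with hb0 | hb0
          · subst hb0; nlinarith
          · exact hb0
        apply hz.1
        have : x • e + y • f = (y / b) • g + (x - a * y / b) • e := by
          simp only [hgdef]; match_scalars <;> field_simp; ring
        rw [this]
        refine hEmem _ _ (by positivity) ?_ ?_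
        · rw [sub_nonneg, div_le_iff₀ hb0]; linarith
        · have : y / b + (x - a * y / b) = (y * (1 - a) + b * x) / b := by field_simp; ring
          rw [this, div_le_one hb0]
          linarith
      · exfalso
        nlinarith
    rw [Set.image_image]
    refine ⟨!₂[(x * (1 - b) + a * y - a) / (1 - a - b), (y * (1 - a) + b * x - b) / (1 - a - b)],
      ⟨?_, ?_, ?_⟩, ?_⟩
    · simpa using div_pos hlam h1'
    · simpa using div_pos hmu h1'
    · simp only [Matrix.cons_val_zero, Matrix.cons_val_one]
      rw [← add_div, div_le_one h1']
      nlinarith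
    · simp only [frameMap_apply, Matrix.cons_val_zero, Matrix.cons_val_one, hgdef]
      match_scalars <;> field_simp <;> ring
  have hsplit : volume ((F \ E) ∩ openCone e f) + volume ((E \ F) ∩ openCone e f) ≤
      volume (symmDiff E F ∩ openCone e f) := by
    rw [← measure_inter_add_sdiff (symmDiff E F ∩ openCone e f) hFc.isClosed.measurableSet]
    refine add_le_add (measure_mono ?_) (measure_mono ?_)
    · rintro z ⟨⟨h1, h2⟩, h3⟩
      exact ⟨⟨Or.inr ⟨h1, h2⟩, h3⟩, h1⟩
    · rintro z ⟨⟨h1, h2⟩, h3⟩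
      exact ⟨⟨Or.inl ⟨h1, h2⟩, h3⟩, h2⟩
  have hXle : X ≤ 20 * (ENNReal.ofReal (a + b) * X) := by
    rw [← mul_assoc]
    refine le_mul_of_one_le_left zero_le ?_
    have : (1 : ENNReal) = 20 * ENNReal.ofReal (1 / 20) := by
      rw [← ENNReal.ofReal_ofNat, ← ENNReal.ofReal_mul (by norm_num)]; norm_num
    rw [this]
    gcongr
  calc _ ≤ X := by
        refine (measure_mono hgap).trans ?_
        rw [Set.image_add_left, measure_preimage_add]
    _ ≤ 20 * (ENNReal.ofReal (a + b) * X) := hXle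
    _ ≤ _ := by
        gcongr
        refine le_trans ?_ hsplit
        rw [ENNReal.ofReal_add ha hb, add_mul]
        gcongr

/-- The determinant of two vectors of the plane. -/
def cross (p q : Plane) : ℝ := p 0 * q 1 - p 1 * q 0

lemma eq_cross_smul_add {e f : Plane} (h : cross e f ≠ 0) (z : Plane) :
    z = (cross z f / cross e f) • e + (cross e z / cross e f) • f := by
  ext i
  simp only [PiLp.add_apply, PiLp.smul_apply, smul_eq_mul]
  rw [div_mul_eq_mul_div, div_mul_eq_mul_div, ← add_div, eq_div_iff h]
  fin_cases i <;> simp only [cross, Fin.zero_eta, Fin.mk_one] <;> ring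

lemma isOpen_openCone {e f : Plane} (h : cross e f ≠ 0) : IsOpen (openCone e f) := by
  have : openCone e f = {z | 0 < cross z f / cross e f ∧ 0 < cross e z / cross e f} := by
    ext z
    constructor
    · rintro ⟨a, b, ha, hb, rfl⟩
      have h1 : cross (a • e + b • f) f / cross e f = a := by
        rw [div_eq_iff h]; simp [cross]; ring
      have h2 : cross e (a • e + b • f) / cross e f = b := by
        rw [div_eq_iff h]; simp [cross]; ring
      exact ⟨by rwa [h1], by rwa [h2]⟩
    · rintro ⟨h1, h2⟩
      exact ⟨_, _, h1, h2, eq_cross_smul_add h z⟩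
  rw [this]
  have h1 : Continuous fun z : Plane => cross z f / cross e f := by unfold cross; fun_prop
  have h2 : Continuous fun z : Plane => cross e z / cross e f := by unfold cross; fun_prop
  exact (isOpen_lt continuous_const h1).inter (isOpen_lt continuous_const h2)

/-- A segment of the boundary of the convex hull of `E ∪ F` bridging from `E` to `F`. -/
structure IsBridge (E F : Set Plane) (e f : Plane) : Prop where
  left_mem : e ∈ E
  right_mem : f ∈ F
  disjoint_inter : Disjoint (segment ℝ e f) (E ∩ F)
  disjoint_union : Disjoint (openSegment ℝ e f) (E ∪ F)
  exists_support : ∃ l : Plane →L[ℝ] ℝ, (∀ x ∈ E ∪ F, l x ≤ 1) ∧ l e = 1 ∧ l f = 1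

lemma IsBridge.cross_ne_zero {E F : Set Plane} {e f : Plane} (h : IsBridge E F e f) :
    cross e f ≠ 0 := by
  intro h0
  obtain ⟨l, -, hle, hlf⟩ := h.exists_support
  have hc (i : Fin 2) : e i • f - f i • e = 0 := by
    ext j
    unfold cross at h0
    fin_cases i <;> fin_cases j <;> simp <;> linarith
  have hef : e = f := by
    ext i
    have := congrArg l (hc i)
    simp only [map_sub, map_smul, hle, hlf, smul_eq_mul, map_zero] at this
    linarith
  subst hef
  exact Set.disjoint_left.1 h.disjoint_inter (left_mem_segment ℝ e e) ⟨h.left_mem, h.right_mem⟩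

lemma lineParam_mem_openSegment {e d p q : Plane} {s t u : ℝ} (hp : p = e + s • d)
    (hq : q = e + t • d) (h1 : s < u) (h2 : u < t) : e + u • d ∈ openSegment ℝ p q := by
  subst hp hq
  have : 0 < t - s := by linarith
  refine ⟨(t - u) / (t - s), (u - s) / (t - s), div_pos (by linarith) this,
    div_pos (by linarith) this, by field_simp; ring, ?_⟩
  match_scalars <;> field_simp <;> ring

lemma IsBridge.eq_of_mem_openCone {E F : Set Plane} (hE : Convex ℝ E) (hF : Convex ℝ F)
    {e f e' f' z : Plane} (h : IsBridge E F e f) (h' : IsBridge E F e' f')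
    (hz : z ∈ openCone e f) (hz' : z ∈ openCone e' f') : e = e' ∧ f = f' := by
  obtain ⟨a, b, ha, hb, rfl⟩ := hz
  obtain ⟨a', b', ha', hb', heq⟩ := hz'
  obtain ⟨l, hl, hle, hlf⟩ := h.exists_support
  obtain ⟨l', hl', hle', hlf'⟩ := h'.exists_support
  have e1 := congrArg l heq
  have e2 := congrArg l' heq
  simp only [map_add, map_smul, smul_eq_mul, hle, hlf, hle', hlf', mul_one] at e1 e2
  have k1 := hl e' (Or.inl h'.left_mem)
  have k2 := hl f' (Or.inr h'.right_mem)
  have k3 := hl' e (Or.inl h.left_mem)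
  have k4 := hl' f (Or.inr h.right_mem)
  have hsum : a + b = a' + b' := by nlinarith
  have hle1 : l e' = 1 := by nlinarith
  have hlf1 : l f' = 1 := by nlinarith
  have line (x : Plane) (hx : l x = 1) : ∃ y : ℝ, x = e + y • (f - e) := by
    have hx' := eq_cross_smul_add h.cross_ne_zero x
    have := congrArg l hx'
    simp only [map_add, map_smul, smul_eq_mul, hle, hlf, mul_one, hx] at this
    refine ⟨cross e x / cross e f, ?_⟩
    nth_rewrite 1 [hx']
    rw [show cross x f / cross e f = 1 - cross e x / cross e f by linarith]
    module
  obtain ⟨y, rfl⟩ := line e' hle1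
  obtain ⟨y', rfl⟩ := line f' hlf1
  set d := f - e with hd
  have hpe : e = e + (0 : ℝ) • d := by simp
  have hpf : f = e + (1 : ℝ) • d := by simp [hd]
  have hd0 : d ≠ 0 := by
    intro h0
    apply h.cross_ne_zero
    have : f = e := by rwa [hd, sub_eq_zero] at h0
    rw [this]; unfold cross; ring
  have hc : 0 < a + b := by positivity
  have hlam : b = a' * y + b' * y' := by
    have : (b - (a' * y + b' * y')) • d = 0 := by
      have h1 : a • e + b • f = (a + b) • e + b • d := by simp only [hd]; module
      have h2 : a' • (e + y • d) + b' • (e + y' • d) =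
        (a + b) • e + (a' * y + b' * y') • d := by rw [hsum]; module
      rw [h1, h2] at heq
      rw [sub_smul, sub_eq_zero]
      exact add_left_cancel heq
    rcases smul_eq_zero.1 this with h0 | h0
    · linarith
    · exact absurd h0 hd0
  set t := b / (a + b) with ht
  have ht0 : 0 < t := by positivity
  have ht1 : t < 1 := by rw [ht, div_lt_one hc]; linarith
  have hw : e + t • d ∉ E ∪ F := by
    exact Set.disjoint_left.1 h.disjoint_union (lineParam_mem_openSegment hpe hpf ht0 ht1)
  rw [Set.mem_union, not_or] at hw
  have hu {u : ℝ} (h0 : 0 < u) (h1 : u < 1) : e + u • d ∉ E ∪ F := by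
    exact Set.disjoint_left.1 h.disjoint_union (lineParam_mem_openSegment hpe hpf h0 h1)
  have hyt : y < t := by
    by_contra! hcon
    rcases hcon.eq_or_lt with h0 | h0
    · exact hw.1 (h0 ▸ h'.left_mem)
    · exact hw.1 (hE.openSegment_subset h.left_mem h'.left_mem
        (lineParam_mem_openSegment hpe rfl ht0 h0))
  have hyt' : t < y' := by
    by_contra! hcon
    rcases hcon.eq_or_lt with h0 | h0
    · exact hw.2 (h0 ▸ h'.right_mem)
    · exact hw.2 (hF.openSegment_subset h'.right_mem h.right_mem
        (lineParam_mem_openSegment rfl hpf h0 ht1))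
  have hy0 : y ≤ 0 := by
    by_contra! hcon
    exact hu hcon (hyt.trans ht1) (Or.inl h'.left_mem)
  have hy1 : 1 ≤ y' := by
    by_contra! hcon
    exact hu (ht0.trans hyt') hcon (Or.inr h'.right_mem)
  have hy0' : y = 0 := by
    by_contra hne
    have := lineParam_mem_openSegment (e := e) (d := d) rfl rfl (lt_of_le_of_ne hy0 hne)
      (show 0 < y' by linarith)
    rw [← hpe] at this
    exact Set.disjoint_left.1 h'.disjoint_union this (Or.inl h.left_mem)
  have hy1' : y' = 1 := by
    by_contra hne
    have := lineParam_mem_openSegment (e := e) (d := d) rfl rfl (show y < 1 by linarith)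
      (lt_of_le_of_ne hy1 (Ne.symm hne))
    rw [← hpf] at this
    exact Set.disjoint_left.1 h'.disjoint_union this (Or.inr h.right_mem)
  subst hy0' hy1'
  exact ⟨hpe, hpf⟩

lemma IsCompact.exists_last_mem {E : Set Plane} (hEc : IsCompact E)
    {x z : Plane} (hx : x ∈ E) (hz : z ∉ E) :
    ∃ s : ℝ, 0 ≤ s ∧ s < 1 ∧ x + s • (z - x) ∈ E ∧
      ∀ t : ℝ, s < t → t ≤ 1 → x + t • (z - x) ∉ E := by
  have hS : IsCompact (Set.Icc (0 : ℝ) 1 ∩ (fun s : ℝ => x + s • (z - x)) ⁻¹' E) :=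
    isCompact_Icc.inter_right (hEc.isClosed.preimage (by fun_prop))
  obtain ⟨s, ⟨hs, hsE⟩, hmax⟩ := hS.exists_isMaxOn ⟨0, ⟨by simp, by simpa using hx⟩⟩
    (f := id) (by fun_prop)
  refine ⟨s, hs.1, lt_of_le_of_ne hs.2 ?_, hsE, fun t hst ht1 htE => ?_⟩
  · rintro rfl
    apply hz
    simpa using hsE
  · exact absurd (hmax ⟨⟨hs.1.trans hst.le, ht1⟩, htE⟩) (not_le.2 hst)

lemma IsCompact.convexHull_union {E F : Set Plane} (hEc : IsCompact E) (hFc : IsCompact F)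
    (hE : Convex ℝ E) (hF : Convex ℝ F) (hEn : E.Nonempty) (hFn : F.Nonempty) :
    IsCompact (convexHull ℝ (E ∪ F)) := by
  have : convexHull ℝ (E ∪ F) = (fun p : (Plane × Plane) × ℝ => (1 - p.2) • p.1.1 + p.2 • p.1.2) ''
      ((E ×ˢ F) ×ˢ Set.Icc 0 1) := by
    rw [hE.convexHull_union hF hEn hFn]
    ext z
    simp only [mem_convexJoin, segment_eq_image, Set.mem_image, Set.mem_prod, Prod.exists]
    constructor
    · rintro ⟨x, hx, y, hy, t, ht, rfl⟩
      exact ⟨x, y, t, ⟨⟨hx, hy⟩, ht⟩, rfl⟩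
    · rintro ⟨x, y, t, ⟨⟨hx, hy⟩, ht⟩, rfl⟩
      exact ⟨x, hx, y, hy, t, ht, rfl⟩
  rw [this]
  exact ((hEc.prod hFc).prod isCompact_Icc).image (by fun_prop)

lemma exists_isBridge {E F : Set Plane} (hE : Convex ℝ E) (hF : Convex ℝ F)
    (hEc : IsCompact E) (hFc : IsCompact F) (h0E : 0 ∈ interior E) (h0F : 0 ∈ F) {z : Plane}
    (hz : z ∈ convexHull ℝ (E ∪ F)) (hzn : z ∉ E ∪ F) :
    ∃ e f, IsBridge E F e f ∧ z ∈ openCone e f := by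
  set K := convexHull ℝ (E ∪ F) with hK
  have hKc : IsCompact K := hEc.convexHull_union hFc hE hF ⟨0, interior_subset h0E⟩ ⟨0, h0F⟩
  have hKconv : Convex ℝ K := convex_convexHull ℝ _
  have h0K : (0 : Plane) ∈ interior K :=
    interior_mono (Set.subset_union_left.trans (subset_convexHull ℝ _)) h0E
  have hz0 : z ≠ 0 := by rintro rfl; exact hzn (Or.inr h0F)
  obtain ⟨R, hR⟩ := hKc.isBounded.exists_norm_le
  have hS : IsCompact (Set.Icc (1 : ℝ) (R / ‖z‖) ∩ (fun c : ℝ => c • z) ⁻¹' K) :=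
    isCompact_Icc.inter_right (hKc.isClosed.preimage (by fun_prop))
  have hzpos : 0 < ‖z‖ := norm_pos_iff.2 hz0
  have hcle {c : ℝ} (hc : 1 ≤ c) (h : c • z ∈ K) : c ≤ R / ‖z‖ := by
    rw [le_div_iff₀ hzpos]
    have := hR _ h
    rwa [norm_smul, Real.norm_of_nonneg (by linarith)] at this
  obtain ⟨c, ⟨hc, hcK⟩, hmax⟩ := hS.exists_isMaxOn
    ⟨1, ⟨le_rfl, hcle le_rfl (by simpa using hz)⟩, by simpa using hz⟩ (f := id) (by fun_prop)
  have hc1 : 1 ≤ c := hc.1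
  have hcpos : 0 < c := by linarith
  change c • z ∈ K at hcK
  have hnint : c • z ∉ interior K := by
    intro hint
    have hnear : ∀ᶠ t : ℝ in nhds c, t • z ∈ interior K :=
      (show Continuous fun t : ℝ => t • z by fun_prop).continuousAt.eventually
        (isOpen_interior.mem_nhds hint)
    obtain ⟨t, ht, htc⟩ := ((hnear.filter_mono nhdsWithin_le_nhds).and
      (self_mem_nhdsWithin : Set.Ioi c ∈ nhdsWithin c (Set.Ioi c))).exists
    have htc' : c < t := htc
    have htK := interior_subset ht
    exact absurd (hmax ⟨⟨by linarith, hcle (by linarith) htK⟩, htK⟩) (not_le.2 htc')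
  obtain ⟨l, hl⟩ := geometric_hahn_banach_open_point hKconv.interior isOpen_interior hnint
  have hlpos : 0 < l (c • z) := by simpa using hl 0 h0K
  have hlK : ∀ x ∈ K, l x ≤ l (c • z) := by
    intro x hx
    have : x ∈ closure (interior K) := by
      rw [hKconv.closure_interior_eq_closure_of_nonempty_interior ⟨0, h0K⟩]
      exact subset_closure hx
    exact closure_minimal (fun y hy => (hl y hy).le)
      (isClosed_le l.continuous continuous_const) this
  set w := c • z with hw
  have hwn : w ∉ E ∪ F := by
    have hzw : z = c⁻¹ • w := by rw [hw, smul_smul, inv_mul_cancel₀ hcpos.ne', one_smul]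
    have hci : c⁻¹ ≤ 1 := inv_le_one_of_one_le₀ hc1
    rintro (h | h)
    · apply hzn; left
      have := hE.smul_add_smul_mem_of_zero_mem (interior_subset h0E) h h (a := c⁻¹) (b := 0)
        (by positivity) le_rfl (by simpa)
      rw [hzw]; simpa using this
    · apply hzn; right
      have := hF.smul_add_smul_mem_of_zero_mem h0F h h (a := c⁻¹) (b := 0)
        (by positivity) le_rfl (by simpa)
      rw [hzw]; simpa using this
  have hwn' := hwn
  rw [Set.mem_union, not_or] at hwn'
  have hwK := hcK
  rw [hK, hE.convexHull_union hF ⟨0, interior_subset h0E⟩ ⟨0, h0F⟩, mem_convexJoin] at hwK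
  obtain ⟨e₀, he₀, f₀, hf₀, α, β, hα, hβ, hαβ, hwαβ⟩ := hwK
  obtain ⟨s, hs0, hs1, hsE, hs⟩ := hEc.exists_last_mem he₀ hwn'.1
  obtain ⟨t, ht0, ht1, htF, ht⟩ := hFc.exists_last_mem hf₀ hwn'.2
  have hα0 : 0 < α := by
    refine lt_of_le_of_ne hα ?_
    rintro rfl
    apply hwn'.2
    rw [← hwαβ, show β = 1 by linarith]
    simpa using hf₀
  have hβ0 : 0 < β := by
    refine lt_of_le_of_ne hβ ?_
    rintro rfl
    apply hwn'.1
    rw [← hwαβ, show α = 1 by linarith]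
    simpa using he₀
  obtain rfl : α = 1 - β := by linarith
  set d := f₀ - e₀ with hd
  set e := e₀ + s • (w - e₀) with he
  set f := f₀ + t • (w - f₀) with hf
  have hwd : w = e₀ + β • d := by rw [← hwαβ, hd]; module
  have hed : e = e₀ + (s * β) • d := by rw [he, hwd, hd]; module
  have hfd : f = e₀ + (1 - t * (1 - β)) • d := by rw [hf, hwd, hd]; module
  have h1 : s * β < β := by nlinarith
  have h2 : β < 1 - t * (1 - β) := by nlinarith
  have hE' {u : ℝ} (hu : s * β < u) (hu1 : u ≤ β) : e₀ + u • d ∉ E := by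
    have := hs (u / β) (by rwa [lt_div_iff₀ hβ0]) (by rwa [div_le_one hβ0])
    convert this using 2
    rw [hwd, add_sub_cancel_left, smul_smul, div_mul_cancel₀ _ hβ0.ne']
  have hF' {u : ℝ} (hu : u < 1 - t * (1 - β)) (hu1 : β ≤ u) : e₀ + u • d ∉ F := by
    have := ht ((1 - u) / (1 - β)) (by rw [lt_div_iff₀ hα0]; linarith)
      (by rw [div_le_one hα0]; linarith)
    convert this using 2
    rw [hwd, hd]
    match_scalars <;> field_simp <;> ring
  have hE'' {u : ℝ} (hu : s * β < u) : e₀ + u • d ∉ E := by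
    rcases le_or_gt u β with h | h
    · exact hE' hu h
    · intro hmem
      apply hwn'.1
      refine hE.openSegment_subset hsE hmem ?_
      rw [hed, hwd]
      exact lineParam_mem_openSegment rfl rfl h1 h
  have hF'' {u : ℝ} (hu : u < 1 - t * (1 - β)) : e₀ + u • d ∉ F := by
    rcases le_or_gt β u with h | h
    · exact hF' hu h
    · intro hmem
      apply hwn'.2
      refine hF.openSegment_subset hmem htF ?_
      rw [hfd, hwd]
      exact lineParam_mem_openSegment rfl rfl h h2
  refine ⟨e, f, ⟨hsE, htF, ?_, ?_, ?_⟩, ?_⟩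
  · rw [Set.disjoint_left]
    rintro _ ⟨x, y, hx, hy, hxy, rfl⟩ ⟨hmE, hmF⟩
    have heq : x • e + y • f = e₀ + (x * (s * β) + y * (1 - t * (1 - β))) • d := by
      rw [hed, hfd, ← eq_sub_iff_add_eq.2 hxy |>.symm]; module
    rw [heq] at hmE hmF
    rcases lt_or_ge (s * β) (x * (s * β) + y * (1 - t * (1 - β))) with h | h
    · exact hE'' h hmE
    · exact hF'' (by linarith) hmF
  · rw [Set.disjoint_left]
    rintro _ ⟨x, y, hx, hy, hxy, rfl⟩ hm
    obtain rfl : x = 1 - y := by linarith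
    have heq : (1 - y) • e + y • f =
        e₀ + ((1 - y) * (s * β) + y * (1 - t * (1 - β))) • d := by
      rw [hed, hfd]; module
    rw [heq] at hm
    rcases hm with hm | hm
    · exact hE'' (by nlinarith) hm
    · exact hF'' (by nlinarith) hm
  · have hlin : l e₀ = l w ∧ l f₀ = l w := by
      have := congrArg l hwαβ
      simp only [map_add, map_smul, smul_eq_mul] at this
      have h1 := hlK e₀ (subset_convexHull ℝ _ (Or.inl he₀))
      have h2 := hlK f₀ (subset_convexHull ℝ _ (Or.inr hf₀))
      constructor <;> nlinarith
    refine ⟨(l w)⁻¹ • l, fun x hx => ?_, ?_, ?_⟩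
    · simp only [smul_apply, smul_eq_mul]
      rw [inv_mul_le_one₀ hlpos]
      exact hlK x (subset_convexHull ℝ _ hx)
    · simp [he, hlin.1, hlpos.ne']
    · simp [hf, hlin.2, hlpos.ne']
  · have hD : 0 < 1 - t * (1 - β) - s * β := by linarith
    refine ⟨(1 - t * (1 - β) - β) / (1 - t * (1 - β) - s * β) / c,
      (β - s * β) / (1 - t * (1 - β) - s * β) / c, ?_, ?_, ?_⟩
    · exact div_pos (div_pos (by linarith) hD) hcpos
    · exact div_pos (div_pos (by linarith) hD) hcpos
    · have hzw : z = c⁻¹ • w := by rw [hw, smul_smul, inv_mul_cancel₀ hcpos.ne', one_smul]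
      have hD' : 1 - t * (1 - β) - s * β ≠ 0 := hD.ne'
      rw [hzw, hed, hfd, hwd]
      generalize 1 - t * (1 - β) = p at *
      generalize s * β = q at *
      match_scalars <;> field_simp <;> ring

lemma volume_convexHull_union_sdiff_le {E F : Set Plane} (hE : Convex ℝ E) (hF : Convex ℝ F)
    (hEc : IsCompact E) (hFc : IsCompact F) (h0E : 0 ∈ interior E) (h0F : 0 ∈ F)
    (hs : ∀ e ∈ E, (1 / 20 : ℝ) • e ∈ F) :
    volume (convexHull ℝ (E ∪ F) \ (E ∪ F)) ≤ 20 * volume (symmDiff E F) := by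
  set C : Set (Set Plane) := {S | ∃ e f, IsBridge E F e f ∧ S = openCone e f} with hC
  have hopen : ∀ S ∈ C, IsOpen S := by
    rintro _ ⟨e, f, h, rfl⟩
    exact isOpen_openCone h.cross_ne_zero
  have hdisj : C.PairwiseDisjoint id := by
    rintro _ ⟨e, f, h, rfl⟩ _ ⟨e', f', h', rfl⟩ hne
    rw [Function.onFun, id, id, Set.disjoint_left]
    intro z hz hz'
    obtain ⟨rfl, rfl⟩ := h.eq_of_mem_openCone hE hF h' hz hz'
    exact hne rfl
  have hcount : C.Countable := by
    refine hdisj.countable_of_isOpen hopen ?_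
    rintro _ ⟨e, f, h, rfl⟩
    exact ⟨(1 : ℝ) • e + (1 : ℝ) • f, 1, 1, one_pos, one_pos, rfl⟩
  have hgap : ∀ S ∈ C, volume ((convexHull ℝ (E ∪ F) \ (E ∪ F)) ∩ S) ≤
      20 * volume (symmDiff E F ∩ S) := by
    rintro _ ⟨e, f, h, rfl⟩
    refine le_trans (measure_mono ?_) (volume_gap_openCone_le hE hF hEc hFc (interior_subset h0E)
      h0F h.left_mem h.right_mem h.disjoint_inter (hs e h.left_mem))
    rintro _ ⟨⟨hzK, hzn⟩, a, b, ha, hb, rfl⟩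
    refine ⟨⟨a, b, ha, hb, ?_, rfl⟩, hzn⟩
    obtain ⟨l, hl, hle, hlf⟩ := h.exists_support
    have : a • e + b • f ∈ {x | l x ≤ 1} :=
      convexHull_min hl (convex_halfSpace_le l.isLinear 1) hzK
    simpa [hle, hlf] using this
  have hmeas : MeasurableSet (symmDiff E F) :=
    hEc.isClosed.measurableSet.symmDiff hFc.isClosed.measurableSet
  calc volume (convexHull ℝ (E ∪ F) \ (E ∪ F))
      ≤ volume (⋃ S ∈ C, (convexHull ℝ (E ∪ F) \ (E ∪ F)) ∩ S) := by
        refine measure_mono fun z hz => ?_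
        obtain ⟨e, f, h, hzc⟩ := exists_isBridge hE hF hEc hFc h0E h0F hz.1 hz.2
        exact Set.mem_biUnion ⟨e, f, h, rfl⟩ ⟨hz, hzc⟩
    _ ≤ ∑' S : C, volume ((convexHull ℝ (E ∪ F) \ (E ∪ F)) ∩ S) :=
        measure_biUnion_le _ hcount _
    _ ≤ ∑' S : C, 20 * volume (symmDiff E F ∩ S) := ENNReal.tsum_le_tsum fun S => hgap S S.2
    _ = 20 * volume (⋃ S ∈ C, symmDiff E F ∩ S) := by
        rw [ENNReal.tsum_mul_left, measure_biUnion (f := fun S => symmDiff E F ∩ S) hcount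
          (fun S hS T hT hne => (hdisj hS hT hne).mono Set.inter_subset_right
            Set.inter_subset_right)
          (fun S hS => hmeas.inter (hopen S hS).measurableSet)]
    _ ≤ 20 * volume (symmDiff E F) := by
        gcongr
        exact Set.iUnion₂_subset fun S _ => Set.inter_subset_left

lemma integrableOn_const_sub_clm {G : Set Plane} (hGc : IsCompact G) (l : Plane →L[ℝ] ℝ) (u : ℝ) :
    IntegrableOn (fun x => u - l x) G :=
  (show Continuous fun x => u - l x by fun_prop).continuousOn.integrableOn_compact hGc

lemma setIntegral_const_sub_clm {G : Set Plane} (hGc : IsCompact G) (hG0 : volume G ≠ 0)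
    (l : Plane →L[ℝ] ℝ) (u : ℝ) :
    ∫ x in G, (u - l x) = volume.real G * (u - l (⨍ x in G, x)) := by
  have hint : IntegrableOn (fun x : Plane => x) G := continuousOn_id.integrableOn_compact hGc
  have hconst : IntegrableOn (fun _ : Plane => u) G := continuousOn_const.integrableOn_compact hGc
  have hGpos : 0 < volume.real G := ENNReal.toReal_pos hG0 hGc.measure_ne_top
  rw [integral_sub hconst (l.integrable_comp hint), setIntegral_const, smul_eq_mul,
    l.integral_comp_comm hint, setAverage_eq, map_smul, smul_eq_mul]
  field_simp

lemma average_mem_interior {G : Set Plane} (hG : Convex ℝ G) (hGc : IsCompact G)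
    (hGi : (interior G).Nonempty) : (⨍ x in G, x) ∈ interior G := by
  have hG0 : volume G ≠ 0 := (Measure.measure_pos_of_nonempty_interior _ hGi).ne'
  by_contra hn
  obtain ⟨l, hl⟩ := geometric_hahn_banach_open_point hG.interior isOpen_interior hn
  set o := ⨍ x in G, x
  have hle : ∀ x ∈ G, l x ≤ l o := by
    intro x hx
    have : x ∈ closure (interior G) := by
      rw [hG.closure_interior_eq_closure_of_nonempty_interior hGi]
      exact subset_closure hx
    exact closure_minimal (fun y hy => (hl y hy).le)
      (isClosed_le l.continuous continuous_const) this
  have h0 := setIntegral_const_sub_clm hGc hG0 l (l o)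
  rw [sub_self, mul_zero, setIntegral_eq_zero_iff_of_nonneg_ae
    ((ae_restrict_iff' hGc.isClosed.measurableSet).2 (.of_forall fun x hx => sub_nonneg.2 (hle x hx)))
    (integrableOn_const_sub_clm hGc l _), Filter.EventuallyEq,
    ae_restrict_iff' hGc.isClosed.measurableSet] at h0
  refine (isOpen_interior.measure_pos volume hGi).ne'
    (measure_mono_null (fun x hx => ?_) (ae_iff.1 h0))
  intro h
  have h1 := h (interior_subset hx)
  have h2 := hl x hx
  simp only [Pi.zero_apply] at h1
  linarith

lemma mul_measureReal_lt_le_of_average {G : Set Plane} (hGc : IsCompact G)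
    (hG0 : volume G ≠ 0) {l : Plane →L[ℝ] ℝ} {u : ℝ} (hu : ∀ x ∈ G, l x ≤ u)
    (hpos : l (⨍ x in G, x) < u) (r : ℝ) :
    (r - 1) * volume.real G ≤
      r * volume.real (G ∩ {x | u - l x < r * (u - l (⨍ x in G, x))}) := by
  have hmarkov := mul_meas_ge_le_integral_of_nonneg (μ := volume.restrict G)
    (f := fun x => u - l x)
    ((ae_restrict_iff' hGc.isClosed.measurableSet).2
      (.of_forall fun x hx => sub_nonneg.2 (hu x hx)))
    (integrableOn_const_sub_clm hGc l u) (r * (u - l (⨍ x in G, x)))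
  rw [setIntegral_const_sub_clm hGc hG0,
    measureReal_restrict_apply (isClosed_le continuous_const (by fun_prop)).measurableSet]
    at hmarkov
  set o := ⨍ x in G, x
  have hopen : MeasurableSet {x | u - l x < r * (u - l o)} :=
    (isOpen_lt (by fun_prop) continuous_const).measurableSet
  have hsplit := measureReal_inter_add_sdiff (μ := volume) (s := G) hopen hGc.measure_ne_top
  have hdiff : G \ {x | u - l x < r * (u - l o)} = {x | r * (u - l o) ≤ u - l x} ∩ G := by
    ext x
    simp [and_comm]
  rw [hdiff] at hsplit
  have h1 : r * volume.real ({x | r * (u - l o) ≤ u - l x} ∩ G) ≤ volume.real G := by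
    refine le_of_mul_le_mul_right ?_ (sub_pos.2 hpos)
    linarith
  rw [← hsplit] at h1 ⊢
  linarith

lemma exists_center {E G : Set Plane} (hE : Convex ℝ E) (hEc : IsCompact E) (hG : Convex ℝ G)
    (hGc : IsCompact G) (hGE : G ⊆ E) (hGi : (interior G).Nonempty)
    (hvol : 5 * volume (E \ G) ≤ volume G) :
    ∃ o ∈ interior G, ∀ e ∈ E, o + (1 / 20 : ℝ) • (e - o) ∈ G := by
  have hG0 : volume G ≠ 0 := (Measure.measure_pos_of_nonempty_interior _ hGi).ne'
  have hfin : volume G ≠ ⊤ := hGc.measure_ne_top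
  have hEfin : volume E ≠ ⊤ := hEc.measure_ne_top
  have hGpos : 0 < volume.real G := ENNReal.toReal_pos hG0 hfin
  have hoi : (⨍ x in G, x) ∈ interior G := average_mem_interior hG hGc hGi
  refine ⟨_, hoi, fun e he => ?_⟩
  by_contra hp
  obtain ⟨l, u, hlu, hup⟩ := geometric_hahn_banach_closed_point hG hGc.isClosed hp
  have hlo := hlu _ (interior_subset hoi)
  have key := mul_measureReal_lt_le_of_average hGc hG0 (fun x hx => (hlu x hx).le) hlo 19
  set o := ⨍ x in G, x
  simp only [map_add, map_smul, map_sub, smul_eq_mul] at hup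
  set S := G ∩ {x | u - l x < 19 * (u - l o)}
  have himg : AffineMap.homothety e (1 / 2 : ℝ) '' S ⊆ E \ G := by
    rintro _ ⟨x, ⟨hxG, hx⟩, rfl⟩
    have hx' : u - l x < 19 * (u - l o) := hx
    have heq : AffineMap.homothety e (1 / 2 : ℝ) x = (1 / 2 : ℝ) • x + (1 / 2 : ℝ) • e := by
      rw [AffineMap.homothety_apply, vsub_eq_sub, vadd_eq_add]
      module
    rw [heq]
    refine ⟨hE (hGE hxG) he (by norm_num) (by norm_num) (by norm_num), fun hmem => ?_⟩
    have := hlu _ hmem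
    simp only [map_add, map_smul, smul_eq_mul] at this
    linarith
  have hle := measureReal_mono himg (μ := volume)
    (ne_top_of_le_ne_top hEfin (measure_mono Set.sdiff_subset))
  have hScale : volume.real (AffineMap.homothety e (1 / 2 : ℝ) '' S) = 1 / 4 * volume.real S := by
    rw [measureReal_def, Measure.addHaar_image_homothety, ENNReal.toReal_mul, ← measureReal_def]
    norm_num [finrank_euclideanSpace]
  have hvol' : 5 * volume.real (E \ G) ≤ volume.real G := by
    have := ENNReal.toReal_mono hfin hvol
    rwa [ENNReal.toReal_mul] at this
  rw [hScale] at hle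
  linarith

lemma volume_add_le_of_isCompact {K L : Set ℝ} (hK : IsCompact K) (hL : IsCompact L)
    (hKn : K.Nonempty) (hLn : L.Nonempty) : volume K + volume L ≤ volume (K + L) := by
  obtain ⟨a, ha, ha'⟩ := hK.exists_isGreatest hKn
  obtain ⟨b, hb, hb'⟩ := hL.exists_isLeast hLn
  have h1 : volume (b +ᵥ K) = volume K := measure_vadd _ _ _
  have h2 : volume (a +ᵥ L) = volume L := measure_vadd _ _ _
  have hm : MeasurableSet (a +ᵥ L) := (hL.vadd a).isClosed.measurableSet
  have h3 : volume ((b +ᵥ K) ∩ (a +ᵥ L)) = 0 := by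
    refine measure_mono_null (t := {a + b}) ?_ Real.volume_singleton
    rintro _ ⟨⟨x, hx, rfl⟩, ⟨y, hy, hxy⟩⟩
    have := ha' hx
    have := hb' hy
    simp only [vadd_eq_add, Set.mem_singleton_iff] at *
    linarith
  rw [← h1, ← h2, ← measure_union_add_inter _ hm, h3, add_zero]
  refine measure_mono (Set.union_subset ?_ ?_)
  · rintro _ ⟨x, hx, rfl⟩
    exact ⟨x, hx, b, hb, add_comm _ _⟩
  · rintro _ ⟨y, hy, rfl⟩
    exact ⟨a, ha, y, hy, rfl⟩

lemma add_le_of_forall_lt_isCompact {S : Set ℝ} (hS : MeasurableSet S) {c d : ENNReal}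
    (hcd : c ≤ d) (h : ∀ K ⊆ S, IsCompact K → K.Nonempty → volume K + c ≤ d) :
    volume S + c ≤ d := by
  rcases eq_or_ne c ⊤ with rfl | hc
  · simpa using hcd
  rw [← ENNReal.le_sub_iff_add_le_right hc hcd]
  refine le_of_forall_lt_imp_le_of_dense fun r hr => ?_
  obtain ⟨K, hKS, hKc, hrK⟩ := hS.exists_lt_isCompact hr
  rw [ENNReal.le_sub_iff_add_le_right hc hcd]
  refine le_trans (add_le_add_left hrK.le c) (h K hKS hKc ?_)
  rw [Set.nonempty_iff_ne_empty]
  rintro rfl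
  simp at hrK

/-- The Brunn–Minkowski inequality on the line. -/
lemma volume_add_volume_le {S T : Set ℝ} (hS : MeasurableSet S) (hT : MeasurableSet T)
    (hSn : S.Nonempty) (hTn : T.Nonempty) : volume S + volume T ≤ volume (S + T) := by
  obtain ⟨s, hs⟩ := hSn
  obtain ⟨t, ht⟩ := hTn
  refine add_le_of_forall_lt_isCompact hS ?_ fun K hKS hK hKn => ?_
  · rw [← measure_vadd volume s T]
    exact measure_mono fun _ ⟨y, hy, h⟩ => ⟨s, hs, y, hy, h⟩
  · rw [add_comm]
    refine add_le_of_forall_lt_isCompact hT ?_ fun L hLT hL hLn => ?_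
    · rw [← measure_vadd volume t K]
      exact measure_mono fun _ ⟨y, hy, h⟩ => ⟨y, hKS hy, t, ht, (add_comm _ _).trans h⟩
    · rw [add_comm]
      exact (volume_add_le_of_isCompact hK hL hKn hLn).trans
        (measure_mono (Set.add_subset_add hKS hLT))

lemma lintegral_add_le_of_superadditive {f g h : ℝ → ℝ} (hf : Measurable f) (hg : Measurable g)
    (hh : Measurable h) (hf0 : ∀ x, 0 ≤ f x) (hg0 : ∀ x, 0 ≤ g x) (hh0 : ∀ x, 0 ≤ h x)
    (hf1 : IsLUB (Set.range f) 1) (hg1 : IsLUB (Set.range g) 1)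
    (hfgh : ∀ t, 0 < t → ∀ x y, t < f x → t < g y → t < h (x + y)) :
    (∫⁻ x, ENNReal.ofReal (f x)) + ∫⁻ x, ENNReal.ofReal (g x) ≤ ∫⁻ x, ENNReal.ofReal (h x) := by
  have hanti : Measurable fun t : ℝ => volume {x | t < f x} :=
    Antitone.measurable fun s t hst => measure_mono fun x (hx : t < f x) => hst.trans_lt hx
  rw [lintegral_eq_lintegral_meas_lt _ (.of_forall hf0) hf.aemeasurable,
    lintegral_eq_lintegral_meas_lt _ (.of_forall hg0) hg.aemeasurable,
    lintegral_eq_lintegral_meas_lt _ (.of_forall hh0) hh.aemeasurable,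
    ← lintegral_add_left hanti]
  refine setLIntegral_mono' measurableSet_Ioi fun t (ht : 0 < t) => ?_
  rcases le_or_gt 1 t with h1 | h1
  · have hfe : {x | t < f x} = ∅ := by
      ext x
      simpa using (hf1.1 ⟨x, rfl⟩).trans h1
    have hge : {x | t < g x} = ∅ := by
      ext x
      simpa using (hg1.1 ⟨x, rfl⟩).trans h1
    simp [hfe, hge]
  · obtain ⟨_, ⟨x, rfl⟩, hx, -⟩ := hf1.exists_between h1
    obtain ⟨_, ⟨y, rfl⟩, hy, -⟩ := hg1.exists_between h1
    refine (volume_add_volume_le (measurableSet_lt measurable_const hf)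
      (measurableSet_lt measurable_const hg) ⟨x, hx⟩ ⟨y, hy⟩).trans (measure_mono ?_)
    rintro _ ⟨x, hx, y, hy, rfl⟩
    exact hfgh t ht x y hx hy

lemma exists_slice_bound {A : Set (ℝ × ℝ)} (hA : IsCompact A) (hA0 : volume A ≠ 0) :
    ∃ M : ℝ, 0 < M ∧ IsLUB (Set.range fun x => volume.real (Prod.mk x ⁻¹' A) / M) 1 := by
  have hbdd : BddAbove (Set.range fun x => volume.real (Prod.mk x ⁻¹' A)) := by
    refine ⟨volume.real (Prod.snd '' A), ?_⟩
    rintro _ ⟨x, rfl⟩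
    exact measureReal_mono (fun y hy => ⟨(x, y), hy, rfl⟩)
      (hA.image continuous_snd).measure_ne_top
  have hlub := isLUB_ciSup hbdd
  set M := ⨆ x, volume.real (Prod.mk x ⁻¹' A)
  have hMpos : 0 < M := by
    by_contra! hM
    apply hA0
    rw [Measure.volume_eq_prod, Measure.prod_apply hA.isClosed.measurableSet]
    refine lintegral_eq_zero_of_ae_eq_zero (.of_forall fun x => ?_)
    have h1 : volume.real (Prod.mk x ⁻¹' A) = 0 :=
      le_antisymm ((hlub.1 ⟨x, rfl⟩).trans hM) measureReal_nonneg
    have h2 : volume (Prod.mk x ⁻¹' A) ≠ ⊤ := ne_top_of_le_ne_top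
      (hA.image continuous_snd).measure_ne_top (measure_mono fun y hy => ⟨(x, y), hy, rfl⟩)
    exact (measureReal_eq_zero_iff h2).1 h1
  refine ⟨M, hMpos, ?_, fun b hb => ?_⟩
  · rintro _ ⟨x, rfl⟩
    exact (div_le_one hMpos).2 (hlub.1 ⟨x, rfl⟩)
  · have : M ≤ b * M := hlub.2 (by
      rintro _ ⟨x, rfl⟩
      exact (div_le_iff₀ hMpos).1 (hb ⟨x, rfl⟩))
    exact le_of_mul_le_mul_right (by linarith) hMpos

lemma isCompact_slice {A : Set (ℝ × ℝ)} (hA : IsCompact A) (x : ℝ) :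
    IsCompact (Prod.mk x ⁻¹' A) := by
  refine (hA.image continuous_snd).of_isClosed_subset (hA.isClosed.preimage (by fun_prop))
    fun y hy => ⟨(x, y), hy, rfl⟩

lemma lintegral_slice_div {A : Set (ℝ × ℝ)} (hA : IsCompact A) {M : ℝ} (hM : 0 < M) :
    ∫⁻ x, ENNReal.ofReal (volume.real (Prod.mk x ⁻¹' A) / M) =
      ENNReal.ofReal (volume.real A / M) := by
  have h (x : ℝ) : ENNReal.ofReal (volume.real (Prod.mk x ⁻¹' A) / M) =
      volume (Prod.mk x ⁻¹' A) * (ENNReal.ofReal M)⁻¹ := by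
    rw [ENNReal.ofReal_div_of_pos hM, ofReal_measureReal (isCompact_slice hA x).measure_ne_top]
    rfl
  simp_rw [h]
  rw [lintegral_mul_const _ (measurable_measure_prodMk_left hA.isClosed.measurableSet),
    ← Measure.prod_apply hA.isClosed.measurableSet, ← Measure.volume_eq_prod,
    ENNReal.ofReal_div_of_pos hM, ofReal_measureReal hA.measure_ne_top]
  rfl

lemma measurable_slice_div {A : Set (ℝ × ℝ)} (hA : IsCompact A) (M : ℝ) :
    Measurable fun x => volume.real (Prod.mk x ⁻¹' A) / M :=
  (measurable_measure_prodMk_left hA.isClosed.measurableSet).ennreal_toReal.div_const M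

/-- The Brunn–Minkowski inequality for compact sets of positive measure in the product plane. -/
lemma sqrt_volume_add_prod {A B : Set (ℝ × ℝ)} (hA : IsCompact A) (hB : IsCompact B)
    (hA0 : volume A ≠ 0) (hB0 : volume B ≠ 0) :
    √(volume.real A) + √(volume.real B) ≤ √(volume.real (A + B)) := by
  obtain ⟨M, hM, hM1⟩ := exists_slice_bound hA hA0
  obtain ⟨N, hN, hN1⟩ := exists_slice_bound hB hB0
  have hMN : 0 < M + N := by positivity
  have key := lintegral_add_le_of_superadditive (measurable_slice_div hA M)
    (measurable_slice_div hB N) (measurable_slice_div (hA.add hB) (M + N))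
    (fun x => by positivity) (fun x => by positivity) (fun x => by positivity) hM1 hN1 ?_
  · rw [lintegral_slice_div hA hM, lintegral_slice_div hB hN, lintegral_slice_div (hA.add hB) hMN,
      ← ENNReal.ofReal_add (by positivity) (by positivity),
      ENNReal.ofReal_le_ofReal_iff (by positivity)] at key
    refine Real.le_sqrt_of_sq_le (le_trans ?_ ((le_div_iff₀ hMN).1 key))
    have ha : √(volume.real A) ^ 2 = volume.real A := Real.sq_sqrt measureReal_nonneg
    have hb : √(volume.real B) ^ 2 = volume.real B := Real.sq_sqrt measureReal_nonneg
    generalize √(volume.real A) = a at *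
    generalize √(volume.real B) = b at *
    rw [← ha, ← hb, ← sub_nonneg]
    have : (a ^ 2 / M + b ^ 2 / N) * (M + N) - (a + b) ^ 2 = (N * a - M * b) ^ 2 / (M * N) := by
      field_simp
      ring
    rw [this]
    positivity
  · intro t ht x y hx hy
    rw [lt_div_iff₀ hM] at hx
    rw [lt_div_iff₀ hN] at hy
    rw [lt_div_iff₀ hMN]
    have hne {C : Set (ℝ × ℝ)} {z : ℝ} (h : 0 < volume.real (Prod.mk z ⁻¹' C)) :
        (Prod.mk z ⁻¹' C).Nonempty := by
      rw [Set.nonempty_iff_ne_empty]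
      intro h0
      simp [h0] at h
    have h1 := volume_add_volume_le (isCompact_slice hA x).isClosed.measurableSet
      (isCompact_slice hB y).isClosed.measurableSet
      (hne (lt_trans (by positivity) hx)) (hne (lt_trans (by positivity) hy))
    have h2 : volume (Prod.mk x ⁻¹' A + Prod.mk y ⁻¹' B) ≤
        volume (Prod.mk (x + y) ⁻¹' (A + B)) := by
      refine measure_mono ?_
      rintro _ ⟨p, hp, q, hq, rfl⟩
      exact ⟨(x, p), hp, (y, q), hq, rfl⟩
    have h3 := ENNReal.toReal_mono (isCompact_slice (hA.add hB) (x + y)).measure_ne_top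
      (h1.trans h2)
    rw [ENNReal.toReal_add (isCompact_slice hA x).measure_ne_top
      (isCompact_slice hB y).measure_ne_top] at h3
    change volume.real _ + volume.real _ ≤ volume.real _ at h3
    linarith

lemma volume_preserving_coords :
    MeasurePreserving (fun z : Plane => (z 0, z 1)) volume volume :=
  (volume_preserving_finTwoArrow ℝ).comp (PiLp.volume_preserving_ofLp (Fin 2))

/-- The planar Brunn–Minkowski inequality for compact sets of positive measure. -/
lemma sqrt_volume_add {A B : Set Plane} (hA : IsCompact A) (hB : IsCompact B)
    (hA0 : volume A ≠ 0) (hB0 : volume B ≠ 0) :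
    √(volume.real A) + √(volume.real B) ≤ √(volume.real (A + B)) := by
  set φ : Plane →ₗ[ℝ] ℝ × ℝ :=
    { toFun := fun z => (z 0, z 1)
      map_add' := fun _ _ => rfl
      map_smul' := fun _ _ => rfl } with hφ
  have hinj : Function.Injective φ := fun p q h => by
    have h' : p 0 = q 0 ∧ p 1 = q 1 := Prod.ext_iff.1 h
    ext i
    fin_cases i
    · exact h'.1
    · exact h'.2
  have hcont : Continuous φ := φ.continuous_of_finiteDimensional
  have hvol {S : Set Plane} (hS : IsCompact S) : volume (φ '' S) = volume S := by
    have h := volume_preserving_coords.measure_preimage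
      (hS.image hcont).isClosed.measurableSet.nullMeasurableSet
    have h2 : (fun z : Plane => (z 0, z 1)) ⁻¹' (φ '' S) = S := Set.preimage_image_eq S hinj
    rw [h2] at h
    exact h.symm
  have key := sqrt_volume_add_prod (hA.image hcont) (hB.image hcont)
    (by rwa [hvol hA]) (by rwa [hvol hB])
  rw [← Set.image_add φ] at key
  simp only [measureReal_def] at key ⊢
  rwa [hvol hA, hvol hB, hvol (hA.add hB)] at key

lemma continuous_measureReal_symmDiff_vadd {E F : Set Plane} (hE : IsCompact E)
    (hF : IsCompact F) : Continuous fun x : Plane => volume.real (symmDiff E (x +ᵥ F)) := by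
  let f : Plane → C(Plane, Plane) := fun x => ⟨fun y => -x + y, by fun_prop⟩
  have hf : Continuous f :=
    ContinuousMap.continuous_of_continuous_uncurry _
      (show Continuous fun p : Plane × Plane => -p.1 + p.2 by fun_prop)
  have hpre (x : Plane) : f x ⁻¹' F = x +ᵥ F := by
    ext y
    rw [Set.mem_vadd_set_iff_neg_vadd_mem]
    rfl
  have hmp (x : Plane) : MeasurePreserving (f x) volume volume := measurePreserving_add_left _ _
  rw [continuous_iff_continuousAt]
  intro x
  have h := tendsto_measure_symmDiff_preimage_nhds_zero (hf.tendsto x) (.of_forall hmp) (hmp x)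
    hF.isClosed.measurableSet.nullMeasurableSet hF.measure_ne_top
  simp_rw [hpre] at h
  have h' := (ENNReal.tendsto_toReal ENNReal.zero_ne_top).comp h
  rw [ENNReal.toReal_zero] at h'
  have hfin {A B : Set Plane} (hA : IsCompact A) (hB : IsCompact B) :
      volume (symmDiff A B) ≠ ⊤ :=
    ne_top_of_le_ne_top (hA.union hB).measure_ne_top
      (measure_mono Set.symmDiff_subset_union)
  have htri {A B C : Set Plane} (hA : IsCompact A) (hB : IsCompact B) (hC : IsCompact C) :
      volume.real (symmDiff A C) ≤ volume.real (symmDiff A B) + volume.real (symmDiff B C) :=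
    (measureReal_mono (symmDiff_triangle A B C)
      (measure_union_ne_top (hfin hA hB) (hfin hB hC))).trans (measureReal_union_le _ _)
  rw [ContinuousAt, tendsto_iff_dist_tendsto_zero]
  refine squeeze_zero (fun _ => dist_nonneg) (fun y => ?_) h'
  rw [Real.dist_eq, abs_sub_le_iff]
  have h1 := htri hE (hF.vadd x) (hF.vadd y)
  have h2 := htri hE (hF.vadd y) (hF.vadd x)
  rw [symmDiff_comm (x +ᵥ F)] at h1
  change _ ≤ volume.real _ ∧ _ ≤ volume.real _
  constructor <;> linarith

lemma exists_minimal_symmDiff_vadd {E F : Set Plane} (hE : IsCompact E) (hF : IsCompact F) :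
    ∃ x₀ : Plane, ∀ x : Plane, volume (symmDiff E (x₀ +ᵥ F)) ≤ volume (symmDiff E (x +ᵥ F)) := by
  have hcont : Continuous fun x : Plane =>
      volume.real E + volume.real F - volume.real (symmDiff E (x +ᵥ F)) :=
    continuous_const.sub (continuous_measureReal_symmDiff_vadd hE hF)
  have hsupp : HasCompactSupport fun x : Plane =>
      volume.real E + volume.real F - volume.real (symmDiff E (x +ᵥ F)) := by
    refine HasCompactSupport.intro ((hE.prod hF).image continuous_sub) fun x hx => ?_
    have hdisj : Disjoint E (x +ᵥ F) := by
      rw [Set.disjoint_left]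
      rintro _ he ⟨y, hy, rfl⟩
      exact hx ⟨(_, y), ⟨he, hy⟩, add_sub_cancel_right _ _⟩
    rw [hdisj.symmDiff_eq_sup]
    change _ - volume.real (E ∪ _) = 0
    rw [measureReal_union hdisj
      (hF.vadd x).isClosed.measurableSet hE.measure_ne_top (hF.vadd x).measure_ne_top]
    simp [measureReal_def, measure_vadd]
  obtain ⟨x₀, hx₀⟩ := hcont.exists_forall_ge_of_hasCompactSupport hsupp
  refine ⟨x₀, fun x => ?_⟩
  have hfin (y : Plane) : volume (symmDiff E (y +ᵥ F)) ≠ ⊤ :=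
    ne_top_of_le_ne_top (hE.union (hF.vadd y)).measure_ne_top
      (measure_mono Set.symmDiff_subset_union)
  rw [← ENNReal.toReal_le_toReal (hfin x₀) (hfin x)]
  have := hx₀ x
  change volume.real _ ≤ volume.real _
  linarith

lemma sqrt_volume_smul (c : ℝ) (hc : 0 ≤ c) (S : Set Plane) :
    √(volume.real (c • S)) = c * √(volume.real S) := by
  rw [measureReal_def, Measure.addHaar_smul, ENNReal.toReal_mul, ← measureReal_def,
    finrank_euclideanSpace, Fintype.card_fin, abs_of_nonneg (by positivity),
    ENNReal.toReal_ofReal (by positivity), Real.sqrt_mul (by positivity), Real.sqrt_sq hc]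

lemma sub_mul_sqrt_add_le {P Q : Set Plane} (hP : Convex ℝ P) (hPc : IsCompact P)
    (hQc : IsCompact Q) (hP0 : volume P ≠ 0) (hQ0 : Q.Nonempty) {a b : ℝ} (hb : 0 < b)
    (hab : b ≤ a) :
    (a - b) * √(volume.real P) + b * √(volume.real (P + Q)) ≤ √(volume.real (a • P + b • Q)) := by
  rcases hab.eq_or_lt with rfl | hab
  · rw [← smul_add, sqrt_volume_smul _ hb.le]
    simp
  have hsplit : a • P + b • Q = (a - b) • P + b • (P + Q) := by
    rw [smul_add, ← add_assoc, ← hP.add_smul (by linarith) hb.le, sub_add_cancel]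
  have hne {c : ℝ} (hc : 0 < c) {S : Set Plane} (hS : volume S ≠ 0) : volume (c • S) ≠ 0 := by
    rw [Measure.addHaar_smul]
    refine mul_ne_zero ?_ hS
    rw [ENNReal.ofReal_ne_zero_iff]
    positivity
  have hPQ : volume (P + Q) ≠ 0 := by
    obtain ⟨q, hq⟩ := hQ0
    refine fun h0 => hP0 (le_antisymm ?_ zero_le)
    rw [← h0, ← measure_vadd volume q P]
    exact measure_mono fun _ ⟨y, hy, h⟩ => ⟨y, hy, q, hq, (add_comm _ _).trans h⟩
  rw [hsplit, ← sqrt_volume_smul _ (sub_pos.2 hab).le, ← sqrt_volume_smul _ hb.le]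
  exact sqrt_volume_add (hPc.smul _) ((hPc.add hQc).smul _) (hne (sub_pos.2 hab) hP0) (hne hb hPQ)

lemma sqrt_volume_add_rescaled_le {E F : Set Plane} (hE : Convex ℝ E) (hF : Convex ℝ F)
    (hEc : IsCompact E) (hFc : IsCompact F) {τ : ℝ}
    (hE0 : 0 < √(volume.real E)) (hF0 : 0 < √(volume.real F))
    (ht : √(volume.real E) / (√(volume.real E) + √(volume.real F)) ∈ Set.Icc τ (1 - τ))
    (hd : √(volume.real (E + F)) / (√(volume.real E) + √(volume.real F)) - 1 ≤ τ / 2) :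
    √(volume.real (E + (√(volume.real E) / √(volume.real F)) • F)) ≤ 5 / 2 * √(volume.real E) := by
  have hne {S : Set Plane} (h : 0 < √(volume.real S)) : volume S ≠ 0 := fun h0 => by
    simp [measureReal_def, h0] at h
  have hn {S : Set Plane} (h : 0 < √(volume.real S)) : S.Nonempty :=
    nonempty_of_measure_ne_zero (hne h)
  set F₁ := (√(volume.real E) / √(volume.real F)) • F with hF₁
  have hF₁v : √(volume.real F₁) = √(volume.real E) := by
    rw [hF₁, sqrt_volume_smul _ (by positivity), div_mul_cancel₀ _ hF0.ne']
  have hF₁c : IsCompact F₁ := hFc.smul _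
  have hFF₁ : F = (√(volume.real F) / √(volume.real E)) • F₁ := by
    rw [hF₁, smul_smul, div_mul_div_cancel₀ hE0.ne', div_self hF0.ne', one_smul]
  have hAB : 0 < √(volume.real E) + √(volume.real F) := by positivity
  obtain ⟨ht1, ht2⟩ := ht
  rw [le_div_iff₀ hAB] at ht1
  rw [div_le_iff₀ hAB] at ht2
  rw [sub_le_iff_le_add, div_le_iff₀ hAB] at hd
  rcases le_total (√(volume.real F)) (√(volume.real E)) with h | h
  · have key := sub_mul_sqrt_add_le hE hEc hF₁c (hne hE0) (hn (by rwa [hF₁v]))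
      (a := 1) (b := √(volume.real F) / √(volume.real E)) (by positivity)
      ((div_le_one hE0).2 h)
    rw [one_smul, ← hFF₁] at key
    generalize √(volume.real (E + F₁)) = X at *
    generalize √(volume.real E) = A at *
    generalize √(volume.real F) = B at *
    have h1 : (1 - B / A) * A = A - B := by field_simp
    rw [h1] at key
    have h2 : B / A * X ≤ B / A * (5 / 2 * A) := by
      have : B / A * (5 / 2 * A) = 5 / 2 * B := by field_simp
      nlinarith
    exact le_of_mul_le_mul_left h2 (by positivity)
  · have key := sub_mul_sqrt_add_le (hF.smul _) hF₁c hEc (hne (by rwa [hF₁v])) (hn hE0)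
      (a := √(volume.real F) / √(volume.real E)) (b := 1) one_pos
      ((one_le_div hE0).2 h)
    rw [one_smul, ← hFF₁, hF₁v, add_comm F E, add_comm F₁ E, one_mul] at key
    generalize √(volume.real (E + F₁)) = X at *
    generalize √(volume.real E) = A at *
    generalize √(volume.real F) = B at *
    have h1 : (B / A - 1) * A = B - A := by field_simp
    rw [h1] at key
    nlinarith

/-- If the symmetric difference of `E` and `F` is small, then the convex hull of `E ∪ F` exceeds
both sets by at most a multiple of it. -/
lemma volume_convexHull_union_sdiff_le_of_small {E F : Set Plane} (hE : Convex ℝ E)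
    (hF : Convex ℝ F) (hEc : IsCompact E) (hFc : IsCompact F) (hEF : volume E = volume F)
    (hsmall : 3 * volume (symmDiff E F) < volume E) :
    volume (convexHull ℝ (E ∪ F) \ E) ≤ 21 * volume (symmDiff E F) ∧
      volume (convexHull ℝ (E ∪ F) \ F) ≤ 21 * volume (symmDiff E F) := by
  have hEm := hEc.isClosed.measurableSet
  have hFm := hFc.isClosed.measurableSet
  have hfin {S : Set Plane} (hS : S ⊆ E ∪ F) : volume S ≠ ⊤ :=
    ne_top_of_le_ne_top (hEc.union hFc).measure_ne_top (measure_mono hS)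
  have h1 : volume.real (E ∩ F) + volume.real (E \ F) = volume.real E :=
    measureReal_inter_add_sdiff hFm hEc.measure_ne_top
  have h2 : volume.real (F ∩ E) + volume.real (F \ E) = volume.real F :=
    measureReal_inter_add_sdiff hEm hFc.measure_ne_top
  have h3 : volume.real (symmDiff E F) = volume.real (E \ F) + volume.real (F \ E) := by
    rw [Set.symmDiff_def]
    exact measureReal_union disjoint_sdiff_sdiff (hFm.diff hEm)
      (hfin (Set.sdiff_subset.trans Set.subset_union_left))
      (hfin (Set.sdiff_subset.trans Set.subset_union_right))
  have h4 : volume.real E = volume.real F := by rw [measureReal_def, hEF, measureReal_def]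
  have h5 : 3 * volume.real (symmDiff E F) < volume.real E := by
    have := ENNReal.toReal_strict_mono hEc.measure_ne_top hsmall
    rwa [ENNReal.toReal_mul] at this
  rw [Set.inter_comm F E] at h2
  have h6 : (0 : ℝ) ≤ volume.real (E \ F) := measureReal_nonneg
  set G := E ∩ F with hG
  have hGc : IsCompact G := hEc.inter hFc
  have hGconv : Convex ℝ G := hE.inter hF
  have hGi : (interior G).Nonempty := by
    by_contra hn
    rw [Set.not_nonempty_iff_eq_empty] at hn
    have hfr := hGconv.addHaar_frontier volume
    rw [hGc.isClosed.frontier_eq, hn, Set.sdiff_empty] at hfr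
    have : volume.real G = 0 := by rw [measureReal_def, hfr, ENNReal.toReal_zero]
    linarith
  have hsd : 5 * volume (E \ G) ≤ volume G := by
    rw [hG, Set.sdiff_self_inter, ← ENNReal.toReal_le_toReal
      (ENNReal.mul_ne_top (by simp) (hfin (Set.sdiff_subset.trans Set.subset_union_left)))
      hGc.measure_ne_top, ENNReal.toReal_mul]
    change 5 * volume.real (E \ F) ≤ volume.real G
    linarith
  obtain ⟨o, hoG, ho⟩ := exists_center hE hEc hGconv hGc Set.inter_subset_left hGi hsd
  have hgap := volume_convexHull_union_sdiff_le (hE.vadd (-o)) (hF.vadd (-o)) (hEc.vadd (-o))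
    (hFc.vadd (-o)) (by
      rw [interior_vadd, Set.mem_vadd_set_iff_neg_vadd_mem]
      simpa using interior_mono Set.inter_subset_left hoG) (by
      rw [Set.mem_vadd_set_iff_neg_vadd_mem]
      simpa using (interior_subset hoG).2) (by
      rintro _ ⟨e, he, rfl⟩
      rw [Set.mem_vadd_set_iff_neg_vadd_mem]
      have := (ho e he).2
      rw [sub_eq_neg_add] at this
      simpa using this)
  rw [← Set.vadd_set_union, convexHull_vadd, ← Set.vadd_set_sdiff, ← Set.vadd_set_symmDiff,
    measure_vadd, measure_vadd] at hgap
  have main {A B : Set Plane} (hAB : symmDiff A B = symmDiff E F) (hU : A ∪ B = E ∪ F) :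
      volume (convexHull ℝ (E ∪ F) \ A) ≤ 21 * volume (symmDiff E F) := by
    calc volume (convexHull ℝ (E ∪ F) \ A)
        ≤ volume (symmDiff E F ∪ (convexHull ℝ (E ∪ F) \ (E ∪ F))) := by
          refine measure_mono fun z ⟨hzK, hzA⟩ => ?_
          rw [← hAB]
          by_cases hz : z ∈ B
          · exact Or.inl (Or.inr ⟨hz, hzA⟩)
          · exact Or.inr ⟨hzK, by rw [← hU]; exact fun h => h.elim hzA hz⟩
      _ ≤ volume (symmDiff E F) + 20 * volume (symmDiff E F) :=
          (measure_union_le _ _).trans (add_le_add le_rfl hgap)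
      _ = 21 * volume (symmDiff E F) := by ring
  exact ⟨main rfl rfl, main (symmDiff_comm _ _) (Set.union_comm _ _)⟩

/-- A convex set containing `E` and a translate of `F`, exceeding both by at most a multiple of
the symmetric difference of `E` and `F`. -/
lemma exists_common_hull {E F : Set Plane} (hE : Convex ℝ E) (hF : Convex ℝ F)
    (hEc : IsCompact E) (hFc : IsCompact F) (hE0 : volume E ≠ 0) (hEF : volume E = volume F)
    (hsum : √(volume.real (E + F)) ≤ 5 / 2 * √(volume.real E)) :
    ∃ (K : Set Plane) (x : Plane), Convex ℝ K ∧ E ⊆ K ∧ x +ᵥ F ⊆ K ∧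
      volume (K \ E) ≤ 21 * volume (symmDiff E F) ∧
      volume (K \ (x +ᵥ F)) ≤ 21 * volume (symmDiff E F) := by
  rcases lt_or_ge (3 * volume (symmDiff E F)) (volume E) with h | h
  · obtain ⟨h1, h2⟩ := volume_convexHull_union_sdiff_le_of_small hE hF hEc hFc hEF h
    refine ⟨convexHull ℝ (E ∪ F), 0, convex_convexHull ℝ _,
      Set.subset_union_left.trans (subset_convexHull ℝ _), ?_, h1, ?_⟩
    · rw [zero_vadd]
      exact Set.subset_union_right.trans (subset_convexHull ℝ _)
    · rwa [zero_vadd]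
  · obtain ⟨e, he⟩ := nonempty_of_measure_ne_zero hE0
    obtain ⟨f, hf⟩ := nonempty_of_measure_ne_zero (hEF ▸ hE0)
    have hK : volume (-f +ᵥ (E + F)) ≤ 21 * volume (symmDiff E F) := by
      have hs : volume.real (E + F) ≤ 7 * volume.real E := by
        have h1 : √(volume.real (E + F)) ^ 2 = _ := Real.sq_sqrt measureReal_nonneg
        have h2 : √(volume.real E) ^ 2 = _ := Real.sq_sqrt measureReal_nonneg
        have h3 := Real.sqrt_nonneg (volume.real (E + F))
        rw [← h1, ← h2]
        nlinarith
      have hs' : volume (E + F) ≤ 7 * volume E := by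
        rw [← ENNReal.toReal_le_toReal (hEc.add hFc).measure_ne_top
          (ENNReal.mul_ne_top (by simp) hEc.measure_ne_top), ENNReal.toReal_mul]
        exact hs
      rw [measure_vadd]
      calc volume (E + F) ≤ 7 * volume E := hs'
        _ ≤ 7 * (3 * volume (symmDiff E F)) := by gcongr
        _ = 21 * volume (symmDiff E F) := by ring
    refine ⟨-f +ᵥ (E + F), e - f, (hE.add hF).vadd _, fun z hz => ?_, ?_,
      (measure_mono Set.sdiff_subset).trans hK, (measure_mono Set.sdiff_subset).trans hK⟩
    · exact ⟨z + f, ⟨z, hz, f, hf, rfl⟩, by simp⟩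
    · rintro _ ⟨y, hy, rfl⟩
      exact ⟨e + y, ⟨e, he, y, hy, rfl⟩, by simp only [vadd_eq_add]; abel⟩

/-- For every τ ∈ (0, 1/2] there is d_τ > 0 such that for convex bodies E, F ⊆ ℝ² with
normalized volume ratio t(E,F) ∈ [τ, 1−τ] and Brunn–Minkowski deficit δ(E,F) ≤ d_τ we have
ω(E,F) ≤ 21·α(E,F): there exist homothetic convex K_E ⊇ E, K_F ⊇ F with
max(|K_E∖E|/|E|, |K_F∖F|/|F|) ≤ 21·inf_x |E Δ (x + s·F)|/|E|, s = √(|E|/|F|). -/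
theorem stmt_10 (τ : ℝ) (hτ : τ ∈ Set.Ioc (0 : ℝ) (1 / 2)) :
    ∃ d : ℝ, 0 < d ∧
      ∀ E F : Set (EuclideanSpace ℝ (Fin 2)),
        Convex ℝ E → Convex ℝ F → IsCompact E → IsCompact F →
        (interior E).Nonempty → (interior F).Nonempty →
        Real.sqrt (volume E).toReal /
            (Real.sqrt (volume E).toReal + Real.sqrt (volume F).toReal) ∈ Set.Icc τ (1 - τ) →
        Real.sqrt (volume (E + F)).toReal /
            (Real.sqrt (volume E).toReal + Real.sqrt (volume F).toReal) - 1 ≤ d →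
        ∃ KE KF : Set (EuclideanSpace ℝ (Fin 2)), Convex ℝ KE ∧ Convex ℝ KF ∧
          E ⊆ KE ∧ F ⊆ KF ∧ (∃ c : ℝ, 0 < c ∧ ∃ w, KF = (fun x => c • x + w) '' KE) ∧
          max (volume (KE \ E) / volume E) (volume (KF \ F) / volume F) ≤
            21 * ⨅ x : EuclideanSpace ℝ (Fin 2),
              volume (symmDiff E
                (x +ᵥ Real.sqrt ((volume E).toReal / (volume F).toReal) • F)) / volume E := by
  refine ⟨τ / 2, half_pos hτ.1, fun E F hE hF hEc hFc hEi hFi ht hd => ?_⟩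
  have hE0 : volume E ≠ 0 := (Measure.measure_pos_of_nonempty_interior _ hEi).ne'
  have hF0 : volume F ≠ 0 := (Measure.measure_pos_of_nonempty_interior _ hFi).ne'
  have hEr : 0 < volume.real E := ENNReal.toReal_pos hE0 hEc.measure_ne_top
  have hFr : 0 < volume.real F := ENNReal.toReal_pos hF0 hFc.measure_ne_top
  have hsum := sqrt_volume_add_rescaled_le hE hF hEc hFc (Real.sqrt_pos.2 hEr)
    (Real.sqrt_pos.2 hFr) ht hd
  rw [← Real.sqrt_div hEr.le] at hsum
  simp only [measureReal_def] at hsum hEr hFr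
  set s := √((volume E).toReal / (volume F).toReal) with hs
  have hs0 : 0 < s := by positivity
  have hsv : volume (s • F) = volume E := by
    rw [Measure.addHaar_smul, finrank_euclideanSpace, Fintype.card_fin, hs,
      Real.sq_sqrt (by positivity), abs_of_nonneg (by positivity), ENNReal.ofReal_div_of_pos hFr,
      ENNReal.ofReal_toReal hEc.measure_ne_top, ENNReal.ofReal_toReal hFc.measure_ne_top,
      ENNReal.div_mul_cancel hF0 hFc.measure_ne_top]
  obtain ⟨x₀, hx₀⟩ := exists_minimal_symmDiff_vadd hEc (hFc.smul s)
  obtain ⟨K, x, hK, hEK, hFK, hKE, hKF⟩ := exists_common_hull hE ((hF.smul s).vadd x₀) hEc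
    ((hFc.smul s).vadd x₀) hE0 (by rw [measure_vadd, hsv]) (by
      have : E + (x₀ +ᵥ s • F) = x₀ +ᵥ (E + s • F) := by
        rw [← Set.singleton_vadd, ← Set.singleton_vadd, vadd_eq_add, vadd_eq_add, add_left_comm]
      rw [this, measureReal_def, measure_vadd]
      exact hsum)
  have hmin : volume (symmDiff E (x₀ +ᵥ s • F)) / volume E ≤
      ⨅ x : Plane, volume (symmDiff E (x +ᵥ s • F)) / volume E :=
    le_iInf fun x => ENNReal.div_le_div_right (hx₀ x) _
  set KF := (fun z => s⁻¹ • z + -(s⁻¹ • (x + x₀))) '' K with hKFdef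
  have himg (S : Set Plane) : (fun z : Plane => s⁻¹ • z + -(s⁻¹ • (x + x₀))) '' S =
      -(s⁻¹ • (x + x₀)) +ᵥ s⁻¹ • S := by
    ext z
    simp [Set.mem_vadd_set, Set.mem_smul_set, add_comm]
  have hFimg : (fun z : Plane => s⁻¹ • z + -(s⁻¹ • (x + x₀))) '' (x +ᵥ x₀ +ᵥ s • F) = F := by
    have h (y : Plane) : s⁻¹ • (x + (x₀ + s • y)) + -(s⁻¹ • (x + x₀)) = y := by
      rw [← add_assoc, smul_add, inv_smul_smul₀ hs0.ne', add_neg_cancel_comm]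
    ext z
    constructor
    · rintro ⟨_, ⟨_, ⟨_, ⟨y, hy, rfl⟩, rfl⟩, rfl⟩, rfl⟩
      simp only [vadd_eq_add]
      rwa [h y]
    · exact fun hz => ⟨_, ⟨_, ⟨_, ⟨z, hz, rfl⟩, rfl⟩, rfl⟩, h z⟩
  have hinj : Function.Injective fun z : Plane => s⁻¹ • z + -(s⁻¹ • (x + x₀)) := by
    intro p q hpq
    simpa [hs0.ne'] using hpq
  have hvol (S : Set Plane) : volume ((fun z : Plane => s⁻¹ • z + -(s⁻¹ • (x + x₀))) '' S) =
      ENNReal.ofReal |(s⁻¹) ^ 2| * volume S := by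
    rw [himg, measure_vadd, Measure.addHaar_smul, finrank_euclideanSpace, Fintype.card_fin]
  have hratio : volume (KF \ F) / volume F = volume (K \ (x +ᵥ x₀ +ᵥ s • F)) / volume E := by
    have hF' : volume F = ENNReal.ofReal |(s⁻¹) ^ 2| * volume E := by
      rw [← hsv, ← measure_vadd volume x₀ (s • F), ← measure_vadd volume x (x₀ +ᵥ s • F), ← hvol,
        hFimg]
    rw [hF']
    nth_rewrite 1 [← hFimg]
    rw [hKFdef, ← Set.image_sdiff hinj, hvol, ENNReal.mul_div_mul_left _ _ _ ENNReal.ofReal_ne_top]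
    rw [ENNReal.ofReal_ne_zero_iff]
    positivity
  have hbound {m : ENNReal} (hm : m ≤ 21 * volume (symmDiff E (x₀ +ᵥ s • F))) :
      m / volume E ≤ 21 * ⨅ x : Plane, volume (symmDiff E (x +ᵥ s • F)) / volume E :=
    calc m / volume E ≤ 21 * volume (symmDiff E (x₀ +ᵥ s • F)) / volume E :=
          ENNReal.div_le_div_right hm _
      _ = 21 * (volume (symmDiff E (x₀ +ᵥ s • F)) / volume E) := mul_div_assoc _ _ _
      _ ≤ _ := by gcongr
  refine ⟨K, KF, hK, ?_, hEK, ?_, ⟨s⁻¹, inv_pos.2 hs0, _, rfl⟩, max_le (hbound hKE) ?_⟩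
  · rw [hKFdef, himg]
    exact (hK.smul _).vadd _
  · rw [← hFimg]
    exact Set.image_mono hFK
  · rw [hratio]
    exact hbound hKF
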